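/- Let C be an m×n Cauchon diagram and let K : v ⇒ c_i and L : v ⇒ c_j be directed paths in the Cauchon graph G_C sharing only their initial vertex v, where K starts with a horizontal edge and L starts with a vertical edge. (1) If L consists only of vertical edges (or has no edges), then w(K)w(L) = w(L)w(K). (2) If L contains a horizontal edge, then w(K)w(L) = q·w(L)w(K). -/

import Mathlib

universe u

/-- Quantum affine space data: a central unit `q` and units `t i j`
satisfying the quantum affine space commutation relations. -/
structure QMData (R : Type u) [Ring R] (m n : ℕ) where
  q : Rˣ
  t : Fin m → Fin n → Rˣ
  q_central : ∀ r : R, (q : R) * r = r * (q : R)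
  row_rel : ∀ (i : Fin m) ⦃j j' : Fin n⦄, j < j' →
    (t i j : R) * (t i j' : R) = (q : R) * ((t i j' : R) * (t i j : R))
  col_rel : ∀ ⦃i i' : Fin m⦄ (j : Fin n), i < i' →
    (t i j : R) * (t i' j : R) = (q : R) * ((t i' j : R) * (t i j : R))
  mixed_rel : ∀ ⦃i i' : Fin m⦄ ⦃j j' : Fin n⦄, i < i' → j ≠ j' →
    (t i j : R) * (t i' j' : R) = (t i' j' : R) * (t i j : R)

/-- `white i j = true` means the square `(i,j)` is white.  The Cauchon
condition: for every black square, either every square above it or every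
square to its left is also black. -/
def IsCauchon {m n : ℕ} (white : Fin m → Fin n → Bool) : Prop :=
  ∀ i j, white i j = false →
    (∀ i' : Fin m, i' < i → white i' j = false) ∨
    (∀ j' : Fin n, j' < j → white i j' = false)

/-- Vertices of the Cauchon graph: white squares, row vertices `r_i`,
column vertices `c_j`. -/
inductive CVertex (m n : ℕ) where
  | sq : Fin m → Fin n → CVertex m n
  | row : Fin m → CVertex m n
  | col : Fin n → CVertex m n
deriving DecidableEq

/-- Directed edges of the Cauchon graph. -/
inductive CEdge {m n : ℕ} (white : Fin m → Fin n → Bool) :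
    CVertex m n → CVertex m n → Prop where
  | fromRow (i : Fin m) (k : Fin n) :
      white i k = true → (∀ k' : Fin n, k < k' → white i k' = false) →
      CEdge white (.row i) (.sq i k)
  | toCol (i : Fin m) (j : Fin n) :
      white i j = true → (∀ i' : Fin m, i < i' → white i' j = false) →
      CEdge white (.sq i j) (.col j)
  | horiz (i : Fin m) (k j : Fin n) :
      j < k → white i k = true → white i j = true →
      (∀ j' : Fin n, j < j' → j' < k → white i j' = false) →
      CEdge white (.sq i k) (.sq i j)
  | vert (i i' : Fin m) (j : Fin n) :
      i < i' → white i j = true → white i' j = true →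
      (∀ l : Fin m, i < l → l < i' → white l j = false) →
      CEdge white (.sq i j) (.sq i' j)

/-- The weight of an edge of the Cauchon graph (1 on non-edges). -/
def wt {R : Type u} {m n : ℕ} [Ring R] (D : QMData R m n) :
    CVertex m n → CVertex m n → R
  | .row i, .sq i' k => if i = i' then (D.t i' k : R) else 1
  | .sq i k, .sq i' j =>
      if i = i' ∧ j < k then (↑((D.t i k)⁻¹) * ↑(D.t i j) : R) else 1
  | _, _ => 1

/-- A pair of vertices spans a horizontal edge (edges from `r_i` are
horizontal; edges between squares are horizontal iff the rows agree). -/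
def Horiz {m n : ℕ} : CVertex m n → CVertex m n → Prop
  | .row _, _ => True
  | .sq i _, .sq i' _ => i = i'
  | _, _ => False

/-- `l` is (the list of vertices of) a directed path from `u` to `v`. -/
def IsPathFrom {m n : ℕ} (white : Fin m → Fin n → Bool) (u v : CVertex m n)
    (l : List (CVertex m n)) : Prop :=
  l.Chain' (CEdge white) ∧ l.head? = some u ∧ l.getLast? = some v

/-- The list of (endpoint pairs of the) edges of a path. -/
def steps {m n : ℕ} (l : List (CVertex m n)) : List (CVertex m n × CVertex m n) :=
  l.zip l.tail

/-- The weight of a path: the ordered product of its edge weights. -/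
def pathWeight {R : Type u} {m n : ℕ} [Ring R] (D : QMData R m n)
    (l : List (CVertex m n)) : R :=
  ((steps l).map fun p => wt D p.1 p.2).prod

/-- The number of inversions (length) of a permutation of `Fin k`. -/
def invCount {k : ℕ} (σ : Equiv.Perm (Fin k)) : ℕ :=
  ((Finset.univ : Finset (Fin k × Fin k)).filter fun p => p.1 < p.2 ∧ σ p.2 < σ p.1).card

/-- The quantum determinant of a `k × k` matrix over a (noncommutative) ring. -/
def qdet {R : Type u} [Ring R] {k : ℕ} (q : Rˣ) (N : Matrix (Fin k) (Fin k) R) : R :=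
  ∑ σ : Equiv.Perm (Fin k),
    (-(q : R)) ^ invCount σ * ((List.finRange k).map fun i => N i (σ i)).prod

/-- The path matrix: entry `(i,j)` is the sum of the weights of all directed
paths from `r_i` to `c_j` (zero when there are none). -/
noncomputable def pathMatrix {R : Type u} {m n : ℕ} [Ring R] (D : QMData R m n)
    (white : Fin m → Fin n → Bool) : Matrix (Fin m) (Fin n) R :=
  Matrix.of fun i j =>
    ∑ᶠ p : {l : List (CVertex m n) // IsPathFrom white (.row i) (.col j) l},
      pathWeight D p.1

/-- An `(R_I, C_J)`-path system: paths `P ℓ : r_{i_ℓ} ⇒ c_{j_{σ ℓ}}`. -/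
structure PathSys {m n : ℕ} (white : Fin m → Fin n → Bool) {k : ℕ}
    (ι : Fin k → Fin m) (κ : Fin k → Fin n) where
  σ : Equiv.Perm (Fin k)
  P : Fin k → List (CVertex m n)
  isPath : ∀ l : Fin k, IsPathFrom white (.row (ι l)) (.col (κ (σ l))) (P l)

/-- A path system is vertex-disjoint if no two of its paths share a vertex. -/
def PathSys.VertexDisjoint {m n : ℕ} {white : Fin m → Fin n → Bool} {k : ℕ}
    {ι : Fin k → Fin m} {κ : Fin k → Fin n} (S : PathSys white ι κ) : Prop :=
  ∀ a b : Fin k, a ≠ b → ∀ x : CVertex m n, x ∈ S.P a → x ∈ S.P b → False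

/-- The weight of a path system: the ordered product `w(P₁)⋯w(P_k)`. -/
def PathSys.weight {R : Type u} {m n : ℕ} [Ring R] (D : QMData R m n)
    {white : Fin m → Fin n → Bool} {k : ℕ} {ι : Fin k → Fin m} {κ : Fin k → Fin n}
    (S : PathSys white ι κ) : R :=
  ((List.finRange k).map fun l => pathWeight D (S.P l)).prod

/-- The `q`-sign of a path system: `(-q) ^ ℓ(σ_P)`. -/
def PathSys.sgnq {R : Type u} {m n : ℕ} [Ring R] (D : QMData R m n)
    {white : Fin m → Fin n → Bool} {k : ℕ} {ι : Fin k → Fin m} {κ : Fin k → Fin n}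
    (S : PathSys white ι κ) : R :=
  (-(D.q : R)) ^ invCount S.σ

/-- `x` and `y` commute up to the factor `q ^ k`. -/
def QCommute {G : Type*} [Group G] (q : G) (k : ℤ) (x y : G) : Prop :=
  x * y = q ^ k * (y * x)

namespace QCommute

variable {G : Type*} [Group G] {q x y z : G} {k l : ℤ}

theorem one_left : QCommute q 0 1 y := by simp [QCommute]

theorem one_right : QCommute q 0 x 1 := by simp [QCommute]

theorem symm (h : QCommute q k x y) : QCommute q (-k) y x := by
  unfold QCommute at *
  rw [h, zpow_neg, inv_mul_cancel_left]

theorem mul_left (hq : ∀ g, Commute q g) (hx : QCommute q k x z) (hy : QCommute q l y z) :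
    QCommute q (k + l) (x * y) z := by
  unfold QCommute at *
  have hc : x * q ^ l = q ^ l * x := ((hq x).zpow_left l).eq.symm
  calc x * y * z = x * q ^ l * (z * y) := by rw [mul_assoc, hy, mul_assoc]
    _ = q ^ l * (x * z) * y := by rw [hc]; simp only [mul_assoc]
    _ = q ^ (k + l) * (z * (x * y)) := by
      rw [hx, add_comm, zpow_add]; simp only [mul_assoc]

theorem inv_left (hq : ∀ g, Commute q g) (h : QCommute q k x y) : QCommute q (-k) x⁻¹ y := by
  unfold QCommute at *
  have hc : x⁻¹ * q ^ (-k) = q ^ (-k) * x⁻¹ := ((hq x⁻¹).zpow_left (-k)).eq.symm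
  have h' : y * x = q ^ (-k) * (x * y) := by rw [h, zpow_neg, inv_mul_cancel_left]
  calc x⁻¹ * y = x⁻¹ * (y * x) * x⁻¹ := by group
    _ = x⁻¹ * q ^ (-k) * (x * y) * x⁻¹ := by rw [h']; simp only [mul_assoc]
    _ = q ^ (-k) * (y * x⁻¹) := by rw [hc]; simp only [mul_assoc, inv_mul_cancel_left]

theorem mul_right (hq : ∀ g, Commute q g) (hy : QCommute q k x y) (hz : QCommute q l x z) :
    QCommute q (k + l) x (y * z) := by
  have h := (mul_left hq hy.symm hz.symm).symm
  rwa [neg_add, neg_neg, neg_neg] at h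

theorem inv_right (hq : ∀ g, Commute q g) (h : QCommute q k x y) : QCommute q (-k) x y⁻¹ := by
  simpa using (inv_left hq h.symm).symm

end QCommute

namespace QMData

variable {R : Type u} [Ring R] {m n : ℕ} (D : QMData R m n)

theorem q_commute (g : Rˣ) : Commute D.q g := Units.ext (D.q_central g)

theorem qCommute_of_row_lt {r e : Fin m} (c d : Fin n) (h : r < e) :
    QCommute D.q (if c = d then 1 else 0) (D.t r c) (D.t e d) := by
  split_ifs with hcd
  · subst hcd
    apply Units.ext
    simpa using D.col_rel c h
  · apply Units.ext
    simpa using D.mixed_rel h hcd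

theorem qCommute_of_col_lt (r : Fin m) {c d : Fin n} (h : c < d) :
    QCommute D.q 1 (D.t r c) (D.t r d) := by
  apply Units.ext
  simpa using D.row_rel r h

end QMData

theorem wt_eq_one_of_not_horiz {R : Type u} [Ring R] {m n : ℕ} (D : QMData R m n)
    {x y : CVertex m n} (h : ¬ Horiz x y) : wt D x y = 1 := by
  cases x <;> cases y <;> simp_all [wt, Horiz]

theorem pathWeight_eq_one_of_not_horiz {R : Type u} [Ring R] {m n : ℕ} (D : QMData R m n)
    {l : List (CVertex m n)} (h : ∀ p ∈ steps l, ¬ Horiz p.1 p.2) : pathWeight D l = 1 := by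
  apply List.prod_eq_one
  intro x hx
  obtain ⟨p, hp, rfl⟩ := List.mem_map.1 hx
  exact wt_eq_one_of_not_horiz D (h p hp)

theorem wt_horiz {R : Type u} [Ring R] {m n : ℕ} (D : QMData R m n) (a : Fin m)
    {b b' : Fin n} (h : b' < b) :
    wt D (.sq a b) (.sq a b') = ((D.t a b)⁻¹ * D.t a b' : Rˣ) := by
  simp [wt, h]

theorem pathWeight_cons_cons {R : Type u} [Ring R] {m n : ℕ} (D : QMData R m n)
    (x y : CVertex m n) (l : List (CVertex m n)) :
    pathWeight D (x :: y :: l) = wt D x y * pathWeight D (y :: l) :=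
  List.prod_cons

/-- `SquarePath D white j a b l w`: the vertex list `l` is a path from the white square `(a, b)`
to the column vertex `c_j`, and its weight is the unit `w`. -/
inductive SquarePath {R : Type u} [Ring R] {m n : ℕ} (D : QMData R m n)
    (white : Fin m → Fin n → Bool) (j : Fin n) :
    Fin m → Fin n → List (CVertex m n) → Rˣ → Prop where
  | last (a : Fin m) : white a j = true → (∀ a' : Fin m, a < a' → white a' j = false) →
      SquarePath D white j a j [.sq a j, .col j] 1
  | horiz {a : Fin m} {b b' : Fin n} {l : List (CVertex m n)} {w : Rˣ} :
      b' < b → white a b = true →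
      (∀ c : Fin n, b' < c → c < b → white a c = false) →
      SquarePath D white j a b' l w →
      SquarePath D white j a b (.sq a b :: l) ((D.t a b)⁻¹ * D.t a b' * w)
  | vert {a a' : Fin m} {b : Fin n} {l : List (CVertex m n)} {w : Rˣ} :
      a < a' → white a b = true →
      (∀ r : Fin m, a < r → r < a' → white r b = false) →
      SquarePath D white j a' b l w →
      SquarePath D white j a b (.sq a b :: l) w

namespace SquarePath

variable {R : Type u} [Ring R] {m n : ℕ} {D : QMData R m n}
  {white : Fin m → Fin n → Bool} {i j : Fin n} {a e : Fin m} {b d : Fin n}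
  {l l' : List (CVertex m n)} {w w' : Rˣ}

theorem white_start (h : SquarePath D white j a b l w) : white a b = true := by
  cases h <;> assumption

theorem start_mem (h : SquarePath D white j a b l w) : CVertex.sq a b ∈ l := by
  cases h <;> simp

theorem col_le (h : SquarePath D white j a b l w) : j ≤ b := by
  induction h with
  | last => exact le_rfl
  | horiz hlt _ _ _ ih => exact ih.trans hlt.le
  | vert _ _ _ _ ih => exact ih

theorem mem_bounds (h : SquarePath D white j a b l w) {r : Fin m} {c : Fin n}
    (hm : CVertex.sq r c ∈ l) : a ≤ r ∧ c ≤ b := by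
  induction h with
  | last => simp_all
  | horiz hlt _ _ _ ih =>
    rcases List.mem_cons.1 hm with h | h
    · cases h; exact ⟨le_rfl, le_rfl⟩
    · exact ⟨(ih h).1, (ih h).2.trans hlt.le⟩
  | vert hlt _ _ _ ih =>
    rcases List.mem_cons.1 hm with h | h
    · cases h; exact ⟨le_rfl, le_rfl⟩
    · exact ⟨hlt.le.trans (ih h).1, (ih h).2⟩

/-- A path that ends in the column of its start visits every white square below the start. -/
theorem mem_of_same_col (h : SquarePath D white j a b l w) (hb : j = b) {r : Fin m}
    (hr : a ≤ r) (hw : white r b = true) : CVertex.sq r b ∈ l := by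
  induction h with
  | last a _ hbot =>
    rcases hr.eq_or_lt with rfl | hlt
    · simp
    · simp [hbot r hlt] at hw
  | horiz hlt _ _ hP => exact absurd (hb ▸ hP.col_le) hlt.not_ge
  | @vert a a' b l w hlt _ hbl hP ih =>
    rcases hr.eq_or_lt with rfl | har
    · simp
    · rcases lt_or_ge r a' with hra | hra
      · simp [hbl r har hra] at hw
      · exact List.mem_cons_of_mem _ (ih hb hra hw)

/-- A path to `c_j` visits the bottom-most white square of column `j`. -/
theorem bottom_mem (h : SquarePath D white j a b l w) {r : Fin m} (hw : white r j = true)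
    (hbot : ∀ r' : Fin m, r < r' → white r' j = false) : CVertex.sq r j ∈ l := by
  induction h with
  | last a ha hbot' =>
    rcases lt_trichotomy a r with h | rfl | h
    · simp [hbot' r h] at hw
    · simp
    · simp [hbot a h] at ha
  | horiz _ _ _ _ ih => exact List.mem_cons_of_mem _ ih
  | vert _ _ _ _ ih => exact List.mem_cons_of_mem _ ih

/-- The generator at a square lying above a path (or to its left in the first row of the path)
commutes with the weight of the path up to a power of `q` that depends only on the columns. -/
theorem qCommute_generator (h : SquarePath D white j e d l w) {r : Fin m} {c : Fin n}
    (hbefore : r < e ∨ r = e ∧ c < d) (hw : white r c = true) (hm : CVertex.sq r c ∉ l) :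
    QCommute D.q ((if c = j then 1 else 0) - (if c = d then 1 else 0)) (D.t r c) w := by
  induction h with
  | last => simpa using QCommute.one_right
  | @horiz e d d' l w hlt _ hbl hP ih =>
    have hm' : CVertex.sq r c ∉ l := fun h => hm (List.mem_cons_of_mem _ h)
    rcases hbefore with hre | ⟨rfl, hcd⟩
    · have h := ((D.qCommute_of_row_lt c d hre).inv_right D.q_commute).mul_right D.q_commute
        (D.qCommute_of_row_lt c d' hre) |>.mul_right D.q_commute (ih (.inl hre) hm')
      convert h using 1
      ring
    · have hcd' : c < d' := by
        rcases lt_trichotomy c d' with h | rfl | h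
        · exact h
        · exact absurd hP.start_mem hm'
        · simp [hbl c h hcd] at hw
      have h := ((D.qCommute_of_col_lt r hcd).inv_right D.q_commute).mul_right D.q_commute
        (D.qCommute_of_col_lt r hcd') |>.mul_right D.q_commute (ih (.inr ⟨rfl, hcd'⟩) hm')
      convert h using 1
      simp [hcd.ne, hcd'.ne]
  | vert hlt _ _ _ ih =>
    refine ih (.inl ?_) fun h => hm (List.mem_cons_of_mem _ h)
    rcases hbefore with h | ⟨rfl, _⟩
    · exact h.trans hlt
    · exact hlt

/-- The weight of a horizontal edge commutes with the weight of a later path up to a power of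
`q` that depends only on the columns. -/
theorem qCommute_edge (h : SquarePath D white j e d l w) {r : Fin m} {c c' : Fin n}
    (hbefore : r < e ∨ r = e ∧ c < d) (hc : c' < c) (hw : white r c = true)
    (hw' : white r c' = true) (hm : CVertex.sq r c ∉ l) (hn : CVertex.sq r c' ∉ l) :
    QCommute D.q (-((if c = j then 1 else 0) - (if c = d then 1 else 0)) +
      ((if c' = j then 1 else 0) - (if c' = d then 1 else 0)))
      ((D.t r c)⁻¹ * D.t r c') w :=
  ((h.qCommute_generator hbefore hw hm).inv_left D.q_commute).mul_left D.q_commute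
    (h.qCommute_generator (hbefore.imp_right fun h => ⟨h.1, hc.trans h.2⟩) hw' hn)

/-- The exponent of `q` arising when the weights of two disjoint paths are interchanged, one from
`(a, b)` to `c_i` and the other from `(e, d)` to `c_j`. -/
def exchangeExp (i : Fin n) (a : Fin m) (b : Fin n) (j : Fin n) (e : Fin m) (d : Fin n) : ℤ :=
  if b < d then (if j = b then -1 else 0)
  else if d < b then (if i = d then 1 else 0)
  else if a < e then (if j = d then 0 else 1)
  else (if i = d then 0 else -1)

theorem exchangeExp_swap (h : (a, b) ≠ (e, d)) :
    exchangeExp j e d i a b = -exchangeExp i a b j e d := by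
  unfold exchangeExp
  rcases lt_trichotomy b d with hbd | rfl | hbd
  · simp only [hbd, hbd.not_gt, if_true, if_false]; split_ifs <;> simp
  · have hne : a ≠ e := fun h' => h (by rw [h'])
    rcases hne.lt_or_gt with hae | hae <;>
      simp only [hae, hae.not_gt, lt_irrefl, if_true, if_false] <;> split_ifs <;> simp
  · simp only [hbd, hbd.not_gt, if_true, if_false]; split_ifs <;> simp

theorem qCommute_of_disjoint (hK : SquarePath D white i a b l w)
    (hL : SquarePath D white j e d l' w')
    (hdisj : ∀ r c, CVertex.sq r c ∈ l → CVertex.sq r c ∉ l') :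
    QCommute D.q (exchangeExp i a b j e d) w w' := by
  induction hN : l.length + l'.length using Nat.strong_induction_on
    generalizing i a b l w j e d l' w' with
  | _ N IH =>
  have hne : (a, b) ≠ (e, d) := by
    intro h
    obtain ⟨rfl, rfl⟩ := Prod.mk.inj h
    exact hdisj _ _ hK.start_mem hL.start_mem
  wlog hbefore : a < e ∨ a = e ∧ b < d generalizing i a b l w j e d l' w'
  · have hafter : e < a ∨ e = a ∧ d < b := by
      rcases lt_trichotomy a e with h | rfl | h
      · exact absurd (.inl h) hbefore
      · rcases lt_trichotomy b d with h' | rfl | h'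
        · exact absurd (.inr ⟨rfl, h'⟩) hbefore
        · exact absurd rfl hne
        · exact .inr ⟨rfl, h'⟩
      · exact .inl h
    have h := (this hL hK (fun r c h h' => hdisj r c h' h) (by omega) hne.symm hafter).symm
    rwa [exchangeExp_swap hne, neg_neg] at h
  cases hK with
  | last a hw hbot =>
    have h0 : exchangeExp i a i j e d = 0 := by
      have hj : ¬ j = i := by
        rintro rfl
        exact hdisj a j (by simp) (hL.bottom_mem hw hbot)
      have hd : ¬ i = d := by
        rintro rfl
        rcases hbefore with h | h
        · simpa [hbot e h] using hL.white_start
        · exact h.2.false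
      unfold exchangeExp
      split_ifs <;> first | rfl | omega
    rw [h0]
    exact QCommute.one_left
  | @horiz _ _ b' l w hlt hw hbl hP =>
    have hdisj' : ∀ r c, CVertex.sq r c ∈ l → CVertex.sq r c ∉ l' := fun r c h =>
      hdisj r c (List.mem_cons_of_mem _ h)
    have h := (hL.qCommute_edge hbefore hlt hw hP.white_start (hdisj _ _ (by simp))
      (hdisj' _ _ hP.start_mem)).mul_left D.q_commute
      (IH _ (by simp at hN; omega) hP hL hdisj' rfl)
    convert h using 1
    clear h IH
    have hi := hP.col_le
    have hj := hL.col_le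
    have hid : b' = d → i ≠ d := by
      rintro rfl rfl
      have hae : a < e := hbefore.resolve_right fun h => (h.2.trans hlt).false
      exact hdisj' _ _ (hP.mem_of_same_col rfl hae.le hL.white_start) hL.start_mem
    have hae : ¬ a < e → b < d := fun h => (hbefore.resolve_left h).2
    have hbj : d < b → b ≠ j := fun h => (hj.trans_lt h).ne'
    unfold exchangeExp
    rcases lt_trichotomy b d with h | rfl | h
    · have h' := hlt.trans h
      simp only [h, h.ne, h', h'.ne, if_true, if_false, eq_comm (a := j)]
      split_ifs <;> rfl
    · have h' : a < e := by by_contra h; exact (hae h).false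
      simp only [hlt, hlt.ne, h', lt_irrefl, if_true, if_false, eq_comm (a := j)]
      split_ifs <;> rfl
    · have h' : a < e := by by_contra h'; exact (hae h').not_gt h
      simp only [h, h.ne', h.not_gt, h', hbj h, if_true, if_false]
      rcases lt_trichotomy b' d with h'' | rfl | h''
      · simp only [h'', h''.ne, (hi.trans_lt h'').ne, if_true, if_false, eq_comm (a := j)]
        split_ifs <;> rfl
      · simp only [lt_irrefl, hid rfl, if_true, if_false, eq_comm (a := j)]
        split_ifs <;> rfl
      · simp only [h'', h''.ne', h''.not_gt, (hj.trans_lt h'').ne', if_true, if_false]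
        split_ifs <;> rfl
  | @vert _ a' _ l _ hlt hw hbl hP =>
    have hdisj' : ∀ r c, CVertex.sq r c ∈ l → CVertex.sq r c ∉ l' := fun r c h =>
      hdisj r c (List.mem_cons_of_mem _ h)
    have h := IH _ (by simp at hN; omega) hP hL hdisj' rfl
    convert h using 1
    have hae : b = d → a < e ∧ a' < e := by
      rintro rfl
      have hae : a < e := hbefore.resolve_right fun h => h.2.false
      refine ⟨hae, ?_⟩
      rcases lt_trichotomy a' e with h | rfl | h
      · exact h
      · exact absurd hL.start_mem (hdisj' _ _ hP.start_mem)
      · simpa [hbl e hae h] using hL.white_start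
    unfold exchangeExp
    split_ifs <;> omega

theorem of_isPathFrom (D : QMData R m n) (h : IsPathFrom white (.sq a b) (.col j) l) :
    ∃ w : Rˣ, SquarePath D white j a b l w ∧ pathWeight D l = w ∧
      ((∃ p ∈ steps l, Horiz p.1 p.2) → j < b) := by
  obtain ⟨hchain, hhead, hlast⟩ := h
  induction l generalizing a b with
  | nil => simp at hhead
  | cons x l ih =>
    obtain rfl : x = .sq a b := by simpa using hhead
    cases l with
    | nil => simp at hlast
    | cons y l =>
      obtain ⟨hxy, hchain⟩ := List.isChain_cons_cons.1 hchain
      have hsteps : ∀ z, steps (z :: y :: l) = (z, y) :: steps (y :: l) := fun _ => rfl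
      have hlast' : (y :: l).getLast? = some (.col j) := by simpa using hlast
      cases hxy with
      | toCol _ _ hw hbot =>
        cases l with
        | nil =>
          obtain rfl : b = j := by simpa using hlast
          exact ⟨1, .last a hw hbot, by simp [pathWeight, steps, wt], by simp [steps, Horiz]⟩
        | cons z l => cases (List.isChain_cons_cons.1 hchain).1
      | horiz _ _ b' hlt hw hw' hbl =>
        obtain ⟨w, hP, hwt, -⟩ := ih hchain rfl hlast'
        refine ⟨_, .horiz hlt hw hbl hP, ?_, fun _ => hP.col_le.trans_lt hlt⟩
        rw [pathWeight_cons_cons, wt_horiz D a hlt, hwt, ← Units.val_mul]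
      | vert _ a' _ hlt hw hw' hbl =>
        obtain ⟨w, hP, hwt, hH⟩ := ih hchain rfl hlast'
        refine ⟨_, .vert hlt hw hbl hP, ?_, ?_⟩
        · rw [pathWeight_cons_cons, wt_eq_one_of_not_horiz D (by exact hlt.ne), hwt, one_mul]
        · rintro ⟨p, hp, hph⟩
          rw [hsteps] at hp
          rcases List.mem_cons.1 hp with rfl | hp
          · exact absurd hph hlt.ne
          · exact hH ⟨p, hp, hph⟩

end SquarePath

/-- for paths `K : v ⇒ c_i` and `L : v ⇒ c_j` sharing only their
initial vertex, `K` starting horizontally and `L` starting vertically: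
(1) if `L` has only vertical edges (or none), weights commute;
(2) if `L` has a horizontal edge, `w(K)w(L) = q·w(L)w(K)`. -/
theorem branching_paths_comm {R : Type u} [Ring R] {m n : ℕ} (D : QMData R m n)
    (white : Fin m → Fin n → Bool) (hC : IsCauchon white)
    (v : CVertex m n) (ci cj : Fin n) (K L : List (CVertex m n))
    (hK : IsPathFrom white v (.col ci) K) (hL : IsPathFrom white v (.col cj) L)
    (hshare : ∀ x : CVertex m n, x ∈ K → x ∈ L → x = v)
    (hKh : ∃ a b rest, K = a :: b :: rest ∧ Horiz a b)
    (hLv : ∀ (a b : CVertex m n) (rest : List (CVertex m n)),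
      L = a :: b :: rest → ¬ Horiz a b) :
    ((∀ p ∈ steps L, ¬ Horiz p.1 p.2) →
      pathWeight D K * pathWeight D L = pathWeight D L * pathWeight D K) ∧
    ((∃ p ∈ steps L, Horiz p.1 p.2) →
      pathWeight D K * pathWeight D L = ↑D.q * (pathWeight D L * pathWeight D K)) := by
  refine ⟨fun hvert => by simp [pathWeight_eq_one_of_not_horiz D hvert], fun hhor => ?_⟩
  obtain ⟨x, y, rest, rfl, hxy⟩ := hKh
  obtain rfl : x = v := by simpa using hK.2.1
  have hKedge := (List.isChain_cons_cons.1 hK.1).1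
  cases hKedge with
  | fromRow =>
    obtain ⟨hchain, hhead, hlast⟩ := hL
    match L, hhead, hlast, hLv with
    | [_], hhead, hlast, _ => simp_all
    | z :: z' :: L, hhead, _, hLv =>
      obtain rfl : z = .row _ := by simpa using hhead
      exact absurd trivial (hLv _ _ _ rfl)
  | toCol => exact hxy.elim
  | vert _ _ _ hlt => exact absurd hxy hlt.ne
  | horiz a b b' hlt hw hw' hbl =>
    obtain ⟨wK, hKP, hwK, -⟩ := SquarePath.of_isPathFrom D hK
    obtain ⟨wL, hLP, hwL, hLcol⟩ := SquarePath.of_isPathFrom D hL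
    have hjb := hLcol hhor
    rw [hwK, hwL]
    suffices h : QCommute D.q 1 wK wL by
      simpa [QCommute, Units.ext_iff] using h
    have hKtail : ∃ w, SquarePath D white ci a b' (.sq a b' :: rest) w ∧
        wK = (D.t a b)⁻¹ * D.t a b' * w := by
      obtain ⟨w, hP, hwt, -⟩ := SquarePath.of_isPathFrom D
        (white := white) (a := a) (b := b') (j := ci) (l := .sq a b' :: rest)
        ⟨(List.isChain_cons_cons.1 hK.1).2, rfl, by simpa using hK.2.2⟩
      refine ⟨w, hP, Units.ext ?_⟩
      rw [← hwK, pathWeight_cons_cons, wt_horiz D a hlt, hwt, ← Units.val_mul]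
    obtain ⟨w, hKP', rfl⟩ := hKtail
    cases hLP with
    | last => exact absurd hjb (lt_irrefl _)
    | @horiz _ _ d L w' hdb _ _ hP =>
      cases hP <;> exact absurd rfl (hLv _ _ _ rfl)
    | @vert _ e _ L _ hae _ _ hP =>
      have hdisj : ∀ r c, CVertex.sq r c ∈ CVertex.sq a b' :: rest → CVertex.sq r c ∉ L := by
        intro r c hr hr'
        have h := hshare _ (List.mem_cons_of_mem _ hr) (List.mem_cons_of_mem _ hr')
        cases h
        exact absurd (hP.mem_bounds hr').1 hae.not_ge
      have hnot : ∀ c, CVertex.sq a c ∉ L := fun c h =>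
        absurd (hP.mem_bounds h).1 hae.not_ge
      have h := (hP.qCommute_edge (.inl hae) hlt hw hw' (hnot _) (hnot _)).mul_left D.q_commute
        (hKP'.qCommute_of_disjoint hP hdisj)
      convert h using 1
      unfold SquarePath.exchangeExp
      split_ifs <;> omega
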